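/- For every δ > 0 there exist constants c_0 > 0 and c_1 > 0 such that for every integer m ≥ 31·(2/δ)^8, every partition (𝒱_I, 𝒱_II) of MVars_m with δ(𝒱_I,𝒱_II) ≥ δ, and every positive integer n ≤ c_0 · m, there exist: a finite set ℒ, a function μ : ℒ → ℝ with μ ≥ 0 and Σ_{L ∈ ℒ} μ(L) = 1, a function assigning to each (L, X, Y) ∈ ℒ × {0,1}^n × {0,1}^n an assignment A_{L,X,Y} : MVars_m → {0,1}, and a function pe from ℒ to 2-element subsets of {1,…,3m}, such that: (1) for all L, X, Y, Y' and every variable v ∈ 𝒱_I, A_{L,X,Y}(v) = A_{L,X,Y'}(v), and for all L, X, X', Y and every variable v ∈ 𝒱_II, A_{L,X,Y}(v) = A_{L,X',Y}(v); (2) every A_{L,X,Y} is non-degenerate; (3) for all L, X, Y, every 2-element set e that is bad for A_{L,X,Y} satisfies e = pe(L) or setdisj_n(X,Y) = 1; (4) for every (X,Y) with setdisj_n(X,Y) = 1 there exists 𝒮 ⊆ ℒ with Σ_{L ∈ 𝒮} μ(L) ≥ δ^8/2^9 such that for every assignment A_0 : MVars_m → {0,1} and every 2-element subset e of {1,…,3m},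 Σ_{L ∈ 𝒮 with A_{L,X,Y} = A_0 and pe(L) = e} μ(L) ≤ (1 − c_1) · Σ_{L ∈ 𝒮 with A_{L,X,Y} = A_0} μ(L). -/

import Mathlib

open scoped Classical

/-- The 2-element subsets of `{1,…,3m}`. -/
abbrev PEdge (m : ℕ) := {e : Finset (Fin (3 * m)) // e.card = 2}

/-- The variable set `MVars_m`: edge variables `x^i_e` (`i ∈ [m]`, `e` a 2-element subset
of `[3m]`) and vertex variables `y^j_u` (`j ∈ [2m+1]`, `u ∈ [3m]`). -/
abbrev MVar (m : ℕ) := (Fin m × PEdge m) ⊕ (Fin (2 * m + 1) × Fin (3 * m))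

/-- `E_i` determined by the first part `𝒱I` of a partition of `MVars_m`:
`{e : x^i_e ∈ 𝒱I}`. -/
noncomputable def Evars (m : ℕ) (VI : Set (MVar m)) (i : Fin m) : Finset (PEdge m) :=
  Finset.univ.filter fun e => Sum.inl (i, e) ∈ VI

/-- `V_j` determined by the second part `𝒱II` of a partition of `MVars_m`:
`{u : y^j_u ∈ 𝒱II}`. -/
noncomputable def Vvars (m : ℕ) (VII : Set (MVar m)) (j : Fin (2 * m + 1)) :
    Finset (Fin (3 * m)) :=
  Finset.univ.filter fun u => Sum.inr (j, u) ∈ VII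

/-- The density `δ(𝒱I,𝒱II)` of a partition of `MVars_m`. -/
noncomputable def densityP (m : ℕ) (VI VII : Set (MVar m)) : ℝ :=
  (∑ i : Fin m × Fin m, ∑ j : Fin 5 → Fin (2 * m + 1),
      ((Finset.univ.inf fun k : Fin 5 =>
        ((Evars m VI i.1).filter fun e => (e : Finset (Fin (3 * m))) ⊆ Vvars m VII (j k)) ∩
        ((Evars m VI i.2).filter fun e => (e : Finset (Fin (3 * m))) ⊆ Vvars m VII (j k))).card
          : ℝ)) /
    ((m : ℝ) ^ 2 * (2 * (m : ℝ) + 1) ^ 5 * ((3 * m).choose 2 : ℝ))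

/-- Non-degeneracy of an assignment `A : MVars_m → {0,1}`. -/
def NonDeg (m : ℕ) (A : MVar m → Bool) : Prop :=
  (∀ i : Fin m, ∃ e : PEdge m, A (Sum.inl (i, e)) = true) ∧
  (∀ i i' : Fin m, i ≠ i' → ∀ e e' : PEdge m, (e : Finset (Fin (3 * m))) ∩ (e' : Finset (Fin (3 * m))) ≠ ∅ →
    ¬(A (Sum.inl (i, e)) = true ∧ A (Sum.inl (i', e')) = true)) ∧
  (∀ j : Fin (2 * m + 1), ∃ u : Fin (3 * m), A (Sum.inr (j, u)) = true) ∧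
  (∀ j j' : Fin (2 * m + 1), j ≠ j' → ∀ u : Fin (3 * m),
    ¬(A (Sum.inr (j, u)) = true ∧ A (Sum.inr (j', u)) = true))

/-- `e = {u,v}` is bad for `A` if `A(y^j_u) = A(y^{j'}_v) = A(x^i_e) = 1` for some
`j, j', i`. -/
def BadEdge (m : ℕ) (A : MVar m → Bool) (e : PEdge m) : Prop :=
  ∃ u v : Fin (3 * m), (e : Finset (Fin (3 * m))) = {u, v} ∧
    ∃ (j j' : Fin (2 * m + 1)) (i : Fin m),
      A (Sum.inr (j, u)) = true ∧ A (Sum.inr (j', v)) = true ∧ A (Sum.inl (i, e)) = true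

/-- `setdisj_n(X,Y) = 1` iff there is `i` with `X_i = Y_i = 1`. -/
def SetDisj (n : ℕ) (X Y : Fin n → Bool) : Prop := ∃ i : Fin n, X i = true ∧ Y i = true

/-- The admissible permutations form a non-empty set. -/
theorem perm_nonempty (m n : ℕ) (R : Fin m → Fin m → Prop) (g : Fin n ↪ Fin m)
    (hR : ∀ i, n ≤ (Finset.univ.filter fun k => R (g i) k).card) :
    ∃ σ : Equiv.Perm (Fin m), ∀ i, R (g i) (σ (g i)) := by
  obtain ⟨h, hinj, hh⟩ := (Finset.all_card_le_biUnion_card_iff_exists_injective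
    (fun i : Fin n => Finset.univ.filter fun k => R (g i) k)).1 (by
      intro s
      rcases s.eq_empty_or_nonempty with rfl | ⟨i, hi⟩
      · simp
      · calc s.card ≤ n := by simpa using Finset.card_le_univ s
          _ ≤ _ := hR i
          _ ≤ _ := Finset.card_le_card (Finset.subset_biUnion_of_mem
            (fun i : Fin n => Finset.univ.filter fun k => R (g i) k) hi))
  have := (Equiv.Perm.isMultiplyPretransitive (Fin m) n).exists_smul_eq g ⟨h, hinj⟩
  obtain ⟨σ, hσ⟩ := this
  refine ⟨σ, fun i => ?_⟩
  have h1 : σ (g i) = h i := by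
    have := congrArg (fun f : Fin n ↪ Fin m => f i) hσ
    simpa using this
  rw [h1]
  simpa using hh i

/-- Admissible permutations, as a finset. -/
noncomputable def adm (m n : ℕ) (R : Fin m → Fin m → Prop) (g : Fin n ↪ Fin m) :
    Finset (Equiv.Perm (Fin m)) :=
  Finset.univ.filter fun σ => ∀ i, R (g i) (σ (g i))

theorem adm_count (m n : ℕ) (R : Fin m → Fin m → Prop) (g : Fin n ↪ Fin m) (s : Fin m)
    (hs : ∀ i, g i ≠ s) (i₀ : Fin n) (ε : ℝ)
    (hR : ε * m ≤ (Finset.univ.filter fun k => R (g i₀) k).card) :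
    (ε * m - n) * (adm m n R g).card ≤
      m * ((adm m n R g).filter fun σ => R (g i₀) (σ s)).card := by
  set T : Finset (Fin m) := Finset.univ \ Finset.univ.image g with hT
  have hsw : ∀ t ∈ T, ((adm m n R g).filter fun σ => R (g i₀) (σ t)).card =
      ((adm m n R g).filter fun σ => R (g i₀) (σ s)).card := by
    intro t ht
    have ht' : ∀ i, g i ≠ t := by
      intro i; simp [hT] at ht; exact ht i
    refine Finset.card_bij' (fun σ _ => σ * Equiv.swap s t) (fun σ _ => σ * Equiv.swap s t)
      ?_ ?_ ?_ ?_
    · intro σ hσ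
      simp only [adm, Finset.mem_filter, Finset.mem_univ, true_and] at hσ ⊢
      refine ⟨fun i => ?_, by simpa using hσ.2⟩
      simpa [Equiv.swap_apply_of_ne_of_ne (hs i) (ht' i)] using hσ.1 i
    · intro σ hσ
      simp only [adm, Finset.mem_filter, Finset.mem_univ, true_and] at hσ ⊢
      refine ⟨fun i => ?_, by simpa using hσ.2⟩
      simpa [Equiv.swap_apply_of_ne_of_ne (hs i) (ht' i)] using hσ.1 i
    · intro σ _; simp [mul_assoc]
    · intro σ _; simp [mul_assoc]
  have hcnt : ∀ σ : Equiv.Perm (Fin m), ε * m - n ≤ (T.filter fun t => R (g i₀) (σ t)).card := by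
    intro σ
    have h1 : (Finset.univ.filter fun k => R (g i₀) k).card =
        (Finset.univ.filter fun t => R (g i₀) (σ t)).card := by
      refine Finset.card_bij' (fun k _ => σ.symm k) (fun t _ => σ t) ?_ ?_ ?_ ?_ <;> simp
    have h2 : (Finset.univ.filter fun t => R (g i₀) (σ t)) ⊆
        (T.filter fun t => R (g i₀) (σ t)) ∪ Finset.univ.image g := by
      intro t ht
      simp only [hT, Finset.mem_union, Finset.mem_filter, Finset.mem_sdiff, Finset.mem_univ,
        true_and] at ht ⊢
      tauto
    have h3 := (Finset.card_le_card h2).trans (Finset.card_union_le _ _)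
    have h4 : (Finset.univ.image g).card ≤ n := by
      simpa using Finset.card_image_le (s := (Finset.univ : Finset (Fin n))) (f := g)
    have h5 : ((Finset.univ.filter fun k => R (g i₀) k).card : ℝ) ≤
        (T.filter fun t => R (g i₀) (σ t)).card + n := by
      exact_mod_cast (by omega)
    linarith
  have hdc : ∑ σ ∈ adm m n R g, (T.filter fun t => R (g i₀) (σ t)).card =
      ∑ t ∈ T, ((adm m n R g).filter fun σ => R (g i₀) (σ t)).card :=
    Finset.sum_card_bipartiteAbove_eq_sum_card_bipartiteBelow
      (fun (σ : Equiv.Perm (Fin m)) (t : Fin m) => R (g i₀) (σ t))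
  rw [Finset.sum_congr rfl hsw, Finset.sum_const, smul_eq_mul] at hdc
  have hTm : T.card ≤ m := by simpa using Finset.card_le_univ T
  calc (ε * m - n) * (adm m n R g).card = ∑ σ ∈ adm m n R g, (ε * m - n) := by
        rw [Finset.sum_const, nsmul_eq_mul, mul_comm]
    _ ≤ ∑ σ ∈ adm m n R g, ((T.filter fun t => R (g i₀) (σ t)).card : ℝ) :=
        Finset.sum_le_sum fun σ _ => hcnt σ
    _ = ((T.card * ((adm m n R g).filter fun σ => R (g i₀) (σ s)).card : ℕ) : ℝ) := by
        rw [← hdc]; push_cast; rfl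
    _ ≤ _ := by
        push_cast
        have : (T.card : ℝ) ≤ m := by exact_mod_cast hTm
        gcongr

/-- Edge with given distinct endpoints. -/
def mkE {m : ℕ} (u v : Fin (3 * m)) (h : u ≠ v) : PEdge m := ⟨{u, v}, Finset.card_pair h⟩

/-- Edge assigned to label `k`. -/
noncomputable def xE {m n : ℕ} (V : Fin 3 → Fin m → Fin (3 * m))
    (hV : ∀ t k t' k', V t k = V t' k' → t = t' ∧ k = k') (g : Fin n ↪ Fin m)
    (σ : Equiv.Perm (Fin m)) (X : Fin n → Bool) (k : Fin m) : PEdge m :=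
  if Function.extend g X (fun _ => true) (σ.symm k) = true then
    mkE (V 1 k) (V 2 k) (fun h => absurd (hV _ _ _ _ h).1 (by decide))
  else mkE (V 0 (σ.symm k)) (V 1 k) (fun h => absurd (hV _ _ _ _ h).1 (by decide))

/-- Vertex assigned to a label. -/
noncomputable def yV {m n : ℕ} (V : Fin 3 → Fin m → Fin (3 * m)) (g : Fin n ↪ Fin m) (s : Fin m)
    (σ : Equiv.Perm (Fin m)) (Y : Fin n → Bool) : Fin m ⊕ Fin m ⊕ Unit → Fin (3 * m)
  | Sum.inl k => if Function.extend g Y (fun _ => true) (σ.symm k) = true then V 1 k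
      else V 0 (σ.symm k)
  | Sum.inr (Sum.inl k) => if (∃ i, g i = σ.symm k) ∨ σ.symm k = s then V 2 k
      else V 0 (σ.symm k)
  | Sum.inr (Sum.inr _) => V 0 s

/-- The assignment. -/
noncomputable def asg {m n : ℕ} (V : Fin 3 → Fin m → Fin (3 * m))
    (hV : ∀ t k t' k', V t k = V t' k' → t = t' ∧ k = k') (g : Fin n ↪ Fin m) (s : Fin m)
    (J : Fin m ⊕ Fin m ⊕ Unit ≃ Fin (2 * m + 1))
    (σ : Equiv.Perm (Fin m)) (X Y : Fin n → Bool) : MVar m → Bool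
  | Sum.inl (i, e) => decide (e = xE V hV g σ X i)
  | Sum.inr (j, u) => decide (u = yV V g s σ Y (J.symm j))

theorem ext_cases {m n : ℕ} (g : Fin n ↪ Fin m) (Y : Fin n → Bool) (l : Fin m) :
    (∃ i, g i = l ∧ Function.extend g Y (fun _ => true) l = Y i) ∨
    ((¬ ∃ i, g i = l) ∧ Function.extend g Y (fun _ => true) l = true) := by
  by_cases h : ∃ i, g i = l
  · obtain ⟨i, rfl⟩ := h
    exact Or.inl ⟨i, rfl, g.injective.extend_apply _ _ _⟩
  · exact Or.inr ⟨h, by rw [Function.extend_apply' _ _ _ h]⟩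

theorem yV_inj {m n : ℕ} (V : Fin 3 → Fin m → Fin (3 * m))
    (hV : ∀ t k t' k', V t k = V t' k' → t = t' ∧ k = k') (g : Fin n ↪ Fin m) (s : Fin m)
    (hs : ∀ i, g i ≠ s) (σ : Equiv.Perm (Fin m)) (Y : Fin n → Bool) :
    Function.Injective (yV V g s σ Y) := by
  have hV' : ∀ t k t' k', V t k = V t' k' ↔ t = t' ∧ k = k' :=
    fun t k t' k' => ⟨hV t k t' k', fun h => by rw [h.1, h.2]⟩
  have hσ : ∀ k k', σ.symm k = σ.symm k' ↔ k = k' := fun k k' => σ.symm.injective.eq_iff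
  have hE := ext_cases g Y
  have h01 : (0 : Fin 3) ≠ 1 := by decide
  have h02 : (0 : Fin 3) ≠ 2 := by decide
  have h12 : (1 : Fin 3) ≠ 2 := by decide
  rintro (k | k | _) (k' | k' | _) h <;> simp only [yV] at h
  all_goals grind

theorem asg_nonDeg {m n : ℕ} (V : Fin 3 → Fin m → Fin (3 * m))
    (hV : ∀ t k t' k', V t k = V t' k' → t = t' ∧ k = k') (g : Fin n ↪ Fin m) (s : Fin m)
    (hs : ∀ i, g i ≠ s) (J : Fin m ⊕ Fin m ⊕ Unit ≃ Fin (2 * m + 1))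
    (σ : Equiv.Perm (Fin m)) (X Y : Fin n → Bool) : NonDeg m (asg V hV g s J σ X Y) := by
  have hσ : ∀ k k', σ.symm k = σ.symm k' → k = k' := fun k k' h => σ.symm.injective h
  refine ⟨fun i => ⟨xE V hV g σ X i, by simp [asg]⟩, ?_, fun j => ⟨_, by simp [asg]; rfl⟩, ?_⟩
  · rintro i i' hii e e' hne ⟨h1, h2⟩
    simp only [asg, decide_eq_true_eq] at h1 h2
    obtain ⟨w, hw⟩ := Finset.nonempty_iff_ne_empty.2 hne
    rw [h1, h2] at hw
    have h01 : (0 : Fin 3) ≠ 1 := by decide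
    have h02 : (0 : Fin 3) ≠ 2 := by decide
    have h12 : (1 : Fin 3) ≠ 2 := by decide
    simp only [Finset.mem_inter, xE] at hw
    split_ifs at hw <;> simp only [mkE, Finset.mem_insert, Finset.mem_singleton] at hw
    all_goals grind
  · rintro j j' hjj u ⟨h1, h2⟩
    simp only [asg, decide_eq_true_eq] at h1 h2
    exact hjj (J.symm.injective (yV_inj V hV g s hs σ Y (h1.symm.trans h2)))

theorem asg_bad {m n : ℕ} (V : Fin 3 → Fin m → Fin (3 * m))
    (hV : ∀ t k t' k', V t k = V t' k' → t = t' ∧ k = k') (g : Fin n ↪ Fin m) (s : Fin m)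
    (hs : ∀ i, g i ≠ s) (J : Fin m ⊕ Fin m ⊕ Unit ≃ Fin (2 * m + 1))
    (σ : Equiv.Perm (Fin m)) (X Y : Fin n → Bool) (e : PEdge m)
    (hb : BadEdge m (asg V hV g s J σ X Y) e) :
    e = mkE (V 1 (σ s)) (V 2 (σ s)) (fun h => absurd (hV _ _ _ _ h).1 (by decide)) ∨
      SetDisj n X Y := by
  obtain ⟨u, v, he, j, j', k, h1, h2, h3⟩ := hb
  simp only [asg, decide_eq_true_eq] at h1 h2 h3
  have hch : ∀ w ∈ (e : Finset (Fin (3 * m))), ∃ t, w = yV V g s σ Y t := by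
    intro w hw
    rw [he] at hw
    simp only [Finset.mem_insert, Finset.mem_singleton] at hw
    rcases hw with rfl | rfl
    · exact ⟨_, h1⟩
    · exact ⟨_, h2⟩
  have h01 : (0 : Fin 3) ≠ 1 := by decide
  have h02 : (0 : Fin 3) ≠ 2 := by decide
  have h12 : (1 : Fin 3) ≠ 2 := by decide
  have hσ : ∀ k k', σ.symm k = σ.symm k' → k = k' := fun k k' h => σ.symm.injective h
  -- which vertices are chosen
  have hc1 : ∀ k t, V 1 k = yV V g s σ Y t →
      Function.extend g Y (fun _ => true) (σ.symm k) = true := by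
    rintro k (k' | k' | _) h <;> simp only [yV] at h
    all_goals grind
  have hc2 : ∀ k t, V 2 k = yV V g s σ Y t → (∃ i, g i = σ.symm k) ∨ σ.symm k = s := by
    rintro k (k' | k' | _) h <;> simp only [yV] at h
    all_goals grind
  have hc0 : ∀ k t, V 0 (σ.symm k) = yV V g s σ Y t → 
      Function.extend g Y (fun _ => true) (σ.symm k) ≠ true ∨ (¬ ∃ i, g i = σ.symm k) := by
    rintro k (k' | k' | _) h <;> simp only [yV] at h
    all_goals grind
  have hX := ext_cases g X (σ.symm k)
  have hY := ext_cases g Y (σ.symm k)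
  unfold xE at h3
  split_ifs at h3 with hx
  · obtain ⟨t1, ht1⟩ := hch (V 1 k) (by simp [h3, mkE])
    obtain ⟨t2, ht2⟩ := hch (V 2 k) (by simp [h3, mkE])
    have a1 := hc1 _ _ ht1
    rcases hc2 _ _ ht2 with ⟨i, hi⟩ | hks
    · right
      refine ⟨i, ?_, ?_⟩
      · rw [← hi, g.injective.extend_apply] at hx; exact hx
      · rw [← hi, g.injective.extend_apply] at a1; exact a1
    · left
      have : σ s = k := by rw [← hks]; simp
      rw [h3]; simp only [this]
  · exfalso
    obtain ⟨t1, ht1⟩ := hch (V 1 k) (by simp [h3, mkE])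
    obtain ⟨t2, ht2⟩ := hch (V 0 (σ.symm k)) (by simp [h3, mkE])
    have a1 := hc1 _ _ ht1
    have a2 := hc0 _ _ ht2
    grind

/-- Swapping a gadget with `X = Y = 1` and the planted slot does not change the assignment. -/
theorem asg_swap {m n : ℕ} (V : Fin 3 → Fin m → Fin (3 * m))
    (hV : ∀ t k t' k', V t k = V t' k' → t = t' ∧ k = k') (g : Fin n ↪ Fin m) (s : Fin m)
    (hs : ∀ i, g i ≠ s) (J : Fin m ⊕ Fin m ⊕ Unit ≃ Fin (2 * m + 1))
    (σ : Equiv.Perm (Fin m)) (X Y : Fin n → Bool) (i : Fin n) (hX : X i = true)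
    (hY : Y i = true) :
    asg V hV g s J (σ * Equiv.swap (g i) s) X Y = asg V hV g s J σ X Y := by
  have hext : ∀ Z : Fin n → Bool, Z i = true →
      Function.extend g Z (fun _ => true) (g i) = true ∧
      Function.extend g Z (fun _ => true) s = true := by
    intro Z hZ
    refine ⟨by rw [g.injective.extend_apply]; exact hZ, ?_⟩
    rw [Function.extend_apply' _ _ _ (by rintro ⟨j, hj⟩; exact hs j hj)]
  have hsymm : ∀ k, (σ * Equiv.swap (g i) s).symm k = Equiv.swap (g i) s (σ.symm k) := by
    intro k
    rw [Equiv.symm_apply_eq]; simp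
  have hcase : ∀ k, (σ.symm k = g i ∧ (σ * Equiv.swap (g i) s).symm k = s) ∨
      (σ.symm k = s ∧ (σ * Equiv.swap (g i) s).symm k = g i) ∨
      ((σ * Equiv.swap (g i) s).symm k = σ.symm k) := by
    intro k
    rw [hsymm]
    by_cases h1 : σ.symm k = g i
    · left; rw [h1]; simp
    by_cases h2 : σ.symm k = s
    · right; left; rw [h2]; simp
    · right; right; exact Equiv.swap_apply_of_ne_of_ne h1 h2
  have hx : ∀ k, xE V hV g (σ * Equiv.swap (g i) s) X k = xE V hV g σ X k := by
    intro k
    unfold xE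
    rcases hcase k with ⟨h1, h2⟩ | ⟨h1, h2⟩ | h1
    · rw [if_pos (by rw [h2]; exact (hext X hX).2), if_pos (by rw [h1]; exact (hext X hX).1)]
    · rw [if_pos (by rw [h2]; exact (hext X hX).1), if_pos (by rw [h1]; exact (hext X hX).2)]
    · simp only [h1]
  have hy : ∀ t, yV V g s (σ * Equiv.swap (g i) s) Y t = yV V g s σ Y t := by
    rintro (k | k | _) <;> simp only [yV]
    · rcases hcase k with ⟨h1, h2⟩ | ⟨h1, h2⟩ | h1
      · rw [if_pos (by rw [h2]; exact (hext Y hY).2), if_pos (by rw [h1]; exact (hext Y hY).1)]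
      · rw [if_pos (by rw [h2]; exact (hext Y hY).1), if_pos (by rw [h1]; exact (hext Y hY).2)]
      · simp only [h1]
    · rcases hcase k with ⟨h1, h2⟩ | ⟨h1, h2⟩ | h1
      · rw [if_pos (by rw [h2]; exact Or.inr rfl), if_pos (by rw [h1]; exact Or.inl ⟨i, rfl⟩)]
      · rw [if_pos (by rw [h2]; exact Or.inl ⟨i, rfl⟩), if_pos (by rw [h1]; exact Or.inr rfl)]
      · simp only [h1]
  funext v
  rcases v with ⟨k, e⟩ | ⟨j, u⟩
  · simp only [asg, hx]
  · simp only [asg, hy]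

/-- `{u,v}` is an edge whose variable with label `k` is in `VI`. -/
def edgeIn {m : ℕ} (VI : Set (MVar m)) (k : Fin m) (u v : Fin (3 * m)) : Prop :=
  ∃ h : u ≠ v, Sum.inl (k, mkE u v h) ∈ VI

/-- Validity of a gadget. -/
def validG {m : ℕ} (VI VII : Set (MVar m)) (k : Fin m) (j : Fin (2 * m + 1))
    (a b c : Fin (3 * m)) : Prop :=
  edgeIn VI k a b ∧ edgeIn VI k b c ∧ Sum.inr (j, a) ∈ VII ∧ Sum.inr (j, b) ∈ VII

theorem construct (m n : ℕ) (VI VII : Set (MVar m)) (hdisj : VI ∩ VII = ∅)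
    (V : Fin 3 → Fin m → Fin (3 * m))
    (hV : ∀ t k t' k', V t k = V t' k' → t = t' ∧ k = k')
    (J : Fin m ⊕ Fin m ⊕ Unit ≃ Fin (2 * m + 1)) (g : Fin n ↪ Fin m) (s : Fin m)
    (hs : ∀ i, g i ≠ s) (ε : ℝ)
    (hε : ∀ i, ε * m ≤ (Finset.univ.filter fun k =>
      validG VI VII k (J (Sum.inl k)) (V 0 (g i)) (V 1 k) (V 2 k)).card)
    (hn : (n : ℝ) ≤ ε / 2 * m) :
      ∃ (N : ℕ) (μ : Fin N → ℝ)
        (Af : Fin N → (Fin n → Bool) → (Fin n → Bool) → MVar m → Bool)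
        (pe : Fin N → PEdge m),
        (∀ L, 0 ≤ μ L) ∧ (∑ L, μ L = 1) ∧
        (∀ L X Y Y', ∀ v ∈ VI, Af L X Y v = Af L X Y' v) ∧
        (∀ L X X' Y, ∀ v ∈ VII, Af L X Y v = Af L X' Y v) ∧
        (∀ L X Y, NonDeg m (Af L X Y)) ∧
        (∀ L X Y, ∀ e : PEdge m, BadEdge m (Af L X Y) e → e = pe L ∨ SetDisj n X Y) ∧
        (∀ X Y, SetDisj n X Y →
          ∃ Sc : Finset (Fin N),
            ε / 2 ≤ ∑ L ∈ Sc, μ L ∧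
            ∀ (A₀ : MVar m → Bool) (e : PEdge m),
              ∑ L ∈ Sc.filter (fun L => Af L X Y = A₀ ∧ pe L = e), μ L ≤
                (1 - 1 / 2) * ∑ L ∈ Sc.filter (fun L => Af L X Y = A₀), μ L) := by
  have hm : (0 : ℝ) < m := by exact_mod_cast (Fin.pos s)
  have hno : ∀ v, v ∈ VI → v ∈ VII → False := by
    intro v h1 h2
    have : v ∈ VI ∩ VII := ⟨h1, h2⟩
    rw [hdisj] at this; exact this
  set R : Fin m → Fin m → Prop := fun l k =>
    validG VI VII k (J (Sum.inl k)) (V 0 l) (V 1 k) (V 2 k) with hR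
  set P := adm m n R g with hP
  have hne : P.Nonempty := by
    obtain ⟨σ, hσ⟩ := perm_nonempty m n R g (by
      intro i
      have h1 := hε i
      have h2 : (n : ℝ) ≤ (Finset.univ.filter fun k => R (g i) k).card := by
        have : (0 : ℝ) ≤ n := Nat.cast_nonneg _
        refine le_trans ?_ h1
        linarith
      exact_mod_cast h2)
    exact ⟨σ, by simp [hP, adm]; exact hσ⟩
  have hcard : (0 : ℝ) < P.card := by exact_mod_cast hne.card_pos
  let eq : P ≃ Fin P.card := P.equivFin
  let f : Fin P.card → Equiv.Perm (Fin m) := fun L => (eq.symm L : Equiv.Perm (Fin m))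
  have hfinj : Function.Injective f := Subtype.val_injective.comp eq.symm.injective
  have hfP : ∀ L, f L ∈ P := fun L => (eq.symm L).2
  have hfS : ∀ σ ∈ P, ∃ L, f L = σ := fun σ h => ⟨eq ⟨σ, h⟩, by simp [f]⟩
  have hadm : ∀ σ, σ ∈ P ↔ ∀ i, R (g i) (σ (g i)) := by intro σ; simp [hP, adm]
  refine ⟨P.card, fun _ => 1 / P.card, fun L X Y => asg V hV g s J (f L) X Y,
    fun L => mkE (V 1 (f L s)) (V 2 (f L s)) (fun h => absurd (hV _ _ _ _ h).1 (by decide)),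
    fun L => by positivity, ?_, ?_, ?_, fun L X Y => asg_nonDeg V hV g s hs J _ X Y,
    fun L X Y e hb => asg_bad V hV g s hs J _ X Y e hb, ?_⟩
  · simp; field_simp
  · rintro L X Y Y' (⟨k, e⟩ | ⟨j, u⟩) hv
    · simp only [asg]
    · simp only [asg]
      rcases hj : J.symm j with k | k | _
      · have hjk : j = J (Sum.inl k) := by rw [← hj]; simp
        have e1 := ext_cases g Y ((f L).symm k)
        have e2 := ext_cases g Y' ((f L).symm k)
        by_cases hl : ∃ i, g i = (f L).symm k
        · obtain ⟨i, hi⟩ := hl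
          have hr := (hadm _).1 (hfP L) i
          rw [hi, Equiv.apply_symm_apply] at hr
          obtain ⟨-, -, q1, q2⟩ := hr
          have n1 : u ≠ V 0 ((f L).symm k) := by
            rintro rfl; rw [hjk] at hv; exact hno _ hv q1
          have n2 : u ≠ V 1 k := by
            rintro rfl; rw [hjk] at hv; exact hno _ hv q2
          have : ∀ Z, u ≠ yV V g s (f L) Z (Sum.inl k) := by
            intro Z; simp only [yV]; split_ifs <;> assumption
          simp [this]
        · have e3 := e1.resolve_left (by rintro ⟨i, hi, -⟩; exact hl ⟨i, hi⟩)
          have e4 := e2.resolve_left (by rintro ⟨i, hi, -⟩; exact hl ⟨i, hi⟩)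
          simp only [yV, e3.2, e4.2]
      · exact decide_eq_decide.2 Iff.rfl
      · exact decide_eq_decide.2 Iff.rfl
  · rintro L X X' Y (⟨k, e⟩ | ⟨j, u⟩) hv
    · simp only [asg]
      have e1 := ext_cases g X ((f L).symm k)
      have e2 := ext_cases g X' ((f L).symm k)
      by_cases hl : ∃ i, g i = (f L).symm k
      · obtain ⟨i, hi⟩ := hl
        have hr := (hadm _).1 (hfP L) i
        rw [hi, Equiv.apply_symm_apply] at hr
        obtain ⟨⟨_, q1⟩, ⟨_, q2⟩, -, -⟩ := hr
        have : ∀ Z, e ≠ xE V hV g (f L) Z k := by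
          intro Z hZ
          unfold xE at hZ
          split_ifs at hZ
          · rw [hZ] at hv; exact hno _ q2 hv
          · rw [hZ] at hv; exact hno _ q1 hv
        simp [this]
      · have e3 := e1.resolve_left (by rintro ⟨i, hi, -⟩; exact hl ⟨i, hi⟩)
        have e4 := e2.resolve_left (by rintro ⟨i, hi, -⟩; exact hl ⟨i, hi⟩)
        simp only [xE, e3.2, e4.2]
    · simp only [asg]
  · rintro X Y ⟨i, hXi, hYi⟩
    have hcnt := adm_count m n R g s hs i ε (hε i)
    rw [← hP] at hcnt
    refine ⟨Finset.univ.filter fun L => R (g i) (f L s), ?_, ?_⟩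
    · have hc : (P.filter fun σ => R (g i) (σ s)).card =
          (Finset.univ.filter fun L => R (g i) (f L s)).card := by
        symm
        refine Finset.card_bij (fun L _ => f L) ?_ (fun _ _ _ _ h => hfinj h) ?_
        · intro L hL
          simp only [Finset.mem_filter, Finset.mem_univ, true_and] at hL ⊢
          exact ⟨hfP L, hL⟩
        · intro σ hσ
          rw [Finset.mem_filter] at hσ
          obtain ⟨L, rfl⟩ := hfS σ hσ.1
          exact ⟨L, by simpa using hσ.2, rfl⟩
      rw [hc] at hcnt
      rw [Finset.sum_const, nsmul_eq_mul, mul_one_div, le_div_iff₀ hcard]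
      have h1 : m * (ε / 2 * P.card) ≤
          m * ((Finset.univ.filter fun L => R (g i) (f L s)).card : ℝ) := by
        refine le_trans ?_ hcnt
        have : (ε / 2 * m) * (P.card : ℝ) ≤ (ε * m - n) * P.card := by
          apply mul_le_mul_of_nonneg_right _ hcard.le
          linarith
        linarith
      exact le_of_mul_le_mul_left h1 hm
    · intro A₀ e
      set Sc := Finset.univ.filter fun L => R (g i) (f L s) with hSc
      set pe : Fin P.card → PEdge m := fun L => mkE (V 1 (f L s)) (V 2 (f L s))
        (fun h => absurd (hV _ _ _ _ h).1 (by decide)) with hpe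
      have key : (Sc.filter (fun L => asg V hV g s J (f L) X Y = A₀ ∧ pe L = e)).card ≤
          (Sc.filter (fun L => asg V hV g s J (f L) X Y = A₀ ∧ ¬ pe L = e)).card := by
        have hsw : ∀ L ∈ Sc, ∃ L', f L' = f L * Equiv.swap (g i) s := by
          intro L hL
          apply hfS
          rw [hadm]
          intro i'
          have hb := (hadm _).1 (hfP L)
          by_cases hii : i' = i
          · subst hii
            simpa [hSc] using hL
          · have : Equiv.swap (g i) s (g i') = g i' :=
              Equiv.swap_apply_of_ne_of_ne (fun h => hii (g.injective h)) (hs i')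
            simpa [this] using hb i'
        choose! w hw using hsw
        refine Finset.card_le_card_of_injOn w ?_ ?_
        · intro L hL
          simp only [Finset.coe_filter, Set.mem_ofPred_eq] at hL ⊢
          obtain ⟨hL1, hL2, hL3⟩ := hL
          have hwL := hw L hL1
          refine ⟨?_, ?_, ?_⟩
          · simp only [hSc, Finset.mem_filter, Finset.mem_univ, true_and, hwL]
            simpa using (hadm _).1 (hfP L) i
          · rw [hwL, asg_swap V hV g s hs J (f L) X Y i hXi hYi]; exact hL2
          · rw [← hL3]
            intro h
            have h2 : V 1 (f (w L) s) ∈ ((pe L : PEdge m) : Finset (Fin (3 * m))) := by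
              rw [← h]; simp [hpe, mkE]
            simp only [hpe, mkE, Finset.mem_insert, Finset.mem_singleton] at h2
            rcases h2 with h2 | h2
            · have h3 := (hV _ _ _ _ h2).2
              rw [hwL] at h3
              simp at h3
              exact hs i h3
            · exact absurd (hV _ _ _ _ h2).1 (by decide)
        · intro L hL L' hL' hLL
          simp only [Finset.coe_filter, Set.mem_ofPred_eq] at hL hL'
          have h1 := hw L hL.1
          have h2 := hw L' hL'.1
          rw [hLL, h2] at h1
          exact hfinj (mul_right_cancel h1).symm
      have hsum : (Sc.filter (fun L => asg V hV g s J (f L) X Y = A₀ ∧ pe L = e)).card +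
          (Sc.filter (fun L => asg V hV g s J (f L) X Y = A₀ ∧ ¬ pe L = e)).card =
          (Sc.filter (fun L => asg V hV g s J (f L) X Y = A₀)).card := by
        rw [← Finset.filter_filter, ← Finset.filter_filter]
        exact Finset.card_filter_add_card_filter_not _
      simp only [Finset.sum_const, nsmul_eq_mul]
      rw [← mul_assoc]
      apply mul_le_mul_of_nonneg_right _ (by positivity)
      have h1 : (2 : ℝ) * (Sc.filter (fun L => asg V hV g s J (f L) X Y = A₀ ∧ pe L = e)).card ≤
          (Sc.filter (fun L => asg V hV g s J (f L) X Y = A₀)).card := by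
        exact_mod_cast (by omega)
      linarith

theorem avg_action {G β : Type*} [Group G] [Fintype G] [MulAction G β] [Fintype β]
    [MulAction.IsPretransitive G β] (F : β → ℝ) (x : β) :
    (Fintype.card β : ℝ) * ∑ π : G, F (π • x) = Fintype.card G * ∑ t, F t := by
  have h1 : ∀ t : β, ∑ π : G, F (π • t) = ∑ π : G, F (π • x) := by
    intro t
    obtain ⟨h, rfl⟩ := MulAction.exists_smul_eq G x t
    simp only [smul_smul]
    exact Equiv.sum_comp (Equiv.mulRight h) (fun π => F (π • x))
  have h2 : ∑ t : β, ∑ π : G, F (π • t) = ∑ π : G, ∑ t : β, F t := by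
    rw [Finset.sum_comm]
    refine Finset.sum_congr rfl fun π _ => ?_
    exact Equiv.sum_comp (MulAction.toPerm π) F
  rw [Finset.sum_congr rfl (fun t _ => h1 t)] at h2
  simpa using h2

/-- The set `E_i[V_j]`. -/
noncomputable def EV (m : ℕ) (VI VII : Set (MVar m)) (i : Fin m) (j : Fin (2 * m + 1)) :
    Finset (PEdge m) :=
  (Evars m VI i).filter fun e => (e : Finset (Fin (3 * m))) ⊆ Vvars m VII j

theorem density_le (m : ℕ) (hm : 1 ≤ m) (VI VII : Set (MVar m)) (δ : ℝ)
    (h : δ ≤ densityP m VI VII) :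
    δ * (m * (2 * m + 1) * ((3 * m).choose 2 : ℝ)) ≤ ∑ i, ∑ j, ((EV m VI VII i j).card : ℝ) := by
  have hm' : (0 : ℝ) < m := by exact_mod_cast hm
  have hC : (0 : ℝ) < ((3 * m).choose 2 : ℝ) := by
    exact_mod_cast Nat.choose_pos (by omega)
  unfold densityP at h
  rw [le_div_iff₀ (by positivity)] at h
  have h1 : (∑ i : Fin m × Fin m, ∑ j : Fin 5 → Fin (2 * m + 1),
      ((Finset.univ.inf fun k : Fin 5 =>
        ((Evars m VI i.1).filter fun e => (e : Finset (Fin (3 * m))) ⊆ Vvars m VII (j k)) ∩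
        ((Evars m VI i.2).filter fun e => (e : Finset (Fin (3 * m))) ⊆ Vvars m VII (j k))).card
          : ℝ)) ≤ ∑ i : Fin m × Fin m, ∑ j : Fin 5 → Fin (2 * m + 1),
            ((EV m VI VII i.1 (j 0)).card : ℝ) := by
    refine Finset.sum_le_sum fun i _ => Finset.sum_le_sum fun j _ => ?_
    have : (Finset.univ.inf fun k : Fin 5 =>
        ((Evars m VI i.1).filter fun e => (e : Finset (Fin (3 * m))) ⊆ Vvars m VII (j k)) ∩
        ((Evars m VI i.2).filter fun e => (e : Finset (Fin (3 * m))) ⊆ Vvars m VII (j k)))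
        ⊆ (EV m VI VII i.1 (j 0)).image Subtype.val := by
      intro w hw
      have hw2 := Finset.mem_of_subset (Finset.inf_le (Finset.mem_univ (0 : Fin 5))) hw
      rw [Finset.mem_inter, Finset.mem_filter] at hw2
      obtain ⟨⟨h3, h4⟩, -⟩ := hw2
      simp only [Finset.bind_def, Finset.pure_def, Finset.mem_sup, Finset.mem_singleton] at h3
      obtain ⟨e, he, rfl⟩ := h3
      exact Finset.mem_image.2 ⟨e, by rw [EV, Finset.mem_filter]; exact ⟨he, h4⟩, rfl⟩
    have h5 := (Finset.card_le_card this).trans Finset.card_image_le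
    exact_mod_cast h5
  have h2 : ∀ F : Fin (2 * m + 1) → ℝ, ∑ j : Fin 5 → Fin (2 * m + 1), F (j 0) =
      (2 * m + 1) ^ 4 * ∑ j, F j := by
    intro F
    rw [← Equiv.sum_comp (Fin.consEquiv (fun _ : Fin 5 => Fin (2 * m + 1))), Fintype.sum_prod_type]
    simp [Fin.consEquiv, Finset.mul_sum]
  have h3 : ∑ i : Fin m × Fin m, ∑ j : Fin 5 → Fin (2 * m + 1),
            ((EV m VI VII i.1 (j 0)).card : ℝ) =
      m * (2 * m + 1) ^ 4 * ∑ i, ∑ j, ((EV m VI VII i j).card : ℝ) := by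
    rw [Fintype.sum_prod_type]
    have h2' : ∀ i, ∑ j : Fin 5 → Fin (2 * m + 1), ((EV m VI VII i (j 0)).card : ℝ) =
        (2 * m + 1) ^ 4 * ∑ j, ((EV m VI VII i j).card : ℝ) :=
      fun i => h2 (fun j => ((EV m VI VII i j).card : ℝ))
    simp only [h2']
    simp only [Finset.sum_const, Finset.card_univ, Fintype.card_fin, nsmul_eq_mul]
    rw [Finset.mul_sum]
    refine Finset.sum_congr rfl fun i _ => ?_
    ring
  rw [h3] at h1
  have h4 := h.trans h1
  have hp : (0 : ℝ) < m * (2 * m + 1) ^ 4 := by positivity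
  refine le_of_mul_le_mul_left ?_ hp
  refine le_trans (le_of_eq ?_) h4
  ring

theorem delta_le_one (m : ℕ) (hm : 1 ≤ m) (VI VII : Set (MVar m)) (δ : ℝ)
    (h : δ ≤ densityP m VI VII) : δ ≤ 1 := by
  have h1 := density_le m hm VI VII δ h
  have hm' : (0 : ℝ) < m := by exact_mod_cast hm
  have hC : (0 : ℝ) < ((3 * m).choose 2 : ℝ) := by
    exact_mod_cast Nat.choose_pos (by omega)
  have h2 : ∑ i, ∑ j, ((EV m VI VII i j).card : ℝ) ≤
      ∑ i : Fin m, ∑ j : Fin (2 * m + 1), ((3 * m).choose 2 : ℝ) := by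
    refine Finset.sum_le_sum fun i _ => Finset.sum_le_sum fun j _ => ?_
    have : (EV m VI VII i j).card ≤ Fintype.card (PEdge m) := Finset.card_le_univ _
    have h3 : Fintype.card (PEdge m) = (3 * m).choose 2 := by
      simp
    rw [h3] at this
    exact_mod_cast this
  simp at h2
  have h5 := h1.trans h2
  have hp : (0 : ℝ) < m * (2 * m + 1) * ((3 * m).choose 2 : ℝ) := by positivity
  by_contra hc
  push Not at hc
  nlinarith [mul_pos (sub_pos.2 hc) hp]

/-- Neighbours of `b` in `E_i[V_j]`. -/
noncomputable def nbr (m : ℕ) (VI VII : Set (MVar m)) (i : Fin m) (j : Fin (2 * m + 1))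
    (b : Fin (3 * m)) : Finset (Fin (3 * m)) :=
  Finset.univ.filter fun a => edgeIn VI i a b ∧ Sum.inr (j, a) ∈ VII ∧ Sum.inr (j, b) ∈ VII

theorem nbr_sum (m : ℕ) (VI VII : Set (MVar m)) (i : Fin m) (j : Fin (2 * m + 1)) :
    2 * (EV m VI VII i j).card ≤ ∑ b, (nbr m VI VII i j b).card := by
  have h1 : ∑ e ∈ EV m VI VII i j, (Finset.univ.filter fun b => b ∈ (e : Finset (Fin (3 * m)))).card
      = ∑ b, ((EV m VI VII i j).filter fun e : PEdge m => b ∈ (e : Finset (Fin (3 * m)))).card := by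
    simp only [Finset.card_filter]
    exact Finset.sum_comm
  have h2 : ∀ e ∈ EV m VI VII i j,
      (Finset.univ.filter fun b => b ∈ (e : Finset (Fin (3 * m)))).card = 2 := by
    intro e _
    have : (Finset.univ.filter fun b => b ∈ (e : Finset (Fin (3 * m)))) = e := by ext; simp
    rw [this, e.2]
  rw [Finset.sum_congr rfl h2, Finset.sum_const, smul_eq_mul, mul_comm] at h1
  rw [h1]
  refine Finset.sum_le_sum fun b _ => ?_
  rw [← Finset.card_image_of_injective _ (Subtype.val_injective (p := fun e : Finset (Fin (3 * m)) =>
    e.card = 2))]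
  have hsub : ((EV m VI VII i j).filter fun e : PEdge m => b ∈ (e : Finset (Fin (3 * m)))).image Subtype.val ⊆
      (nbr m VI VII i j b).image (fun a => ({a, b} : Finset (Fin (3 * m)))) := by
    intro w hw
    simp only [Finset.mem_image, Finset.mem_filter, EV, Evars, Finset.mem_univ, true_and] at hw
    obtain ⟨e, ⟨⟨he1, he2⟩, hb⟩, rfl⟩ := hw
    obtain ⟨x, y, hxy, hexy⟩ := Finset.card_eq_two.1 e.2
    have hab : ∃ a, a ≠ b ∧ (e : Finset (Fin (3 * m))) = {a, b} := by
      rw [hexy] at hb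
      simp only [Finset.mem_insert, Finset.mem_singleton] at hb
      rcases hb with rfl | rfl
      · exact ⟨y, hxy.symm, by rw [hexy, Finset.pair_comm]⟩
      · exact ⟨x, hxy, hexy⟩
    obtain ⟨a, hne, hea⟩ := hab
    rw [Finset.mem_image]
    refine ⟨a, ?_, hea.symm⟩
    have hmk : e = mkE a b hne := Subtype.ext hea
    simp only [nbr, Finset.mem_filter, Finset.mem_univ, true_and]
    have ha : a ∈ Vvars m VII j := he2 (by rw [hea]; simp)
    have hb' : b ∈ Vvars m VII j := he2 (by rw [hea]; simp)
    simp only [Vvars, Finset.mem_filter, Finset.mem_univ, true_and] at ha hb'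
    exact ⟨⟨hne, hmk ▸ he1⟩, ha, hb'⟩
  exact (Finset.card_le_card hsub).trans Finset.card_image_le

theorem emb_count (m : ℕ) (VI VII : Set (MVar m)) (i : Fin m) (j : Fin (2 * m + 1)) :
    ∑ b, (nbr m VI VII i j b).offDiag.card ≤
      (Finset.univ.filter fun t : Fin 3 ↪ Fin (3 * m) =>
        validG VI VII i j (t 0) (t 1) (t 2)).card := by
  rw [← Finset.card_sigma]
  refine Finset.card_le_card_of_surjOn
    (fun t : Fin 3 ↪ Fin (3 * m) => (⟨t 1, (t 0, t 2)⟩ : Σ _ : Fin (3 * m), Fin (3 * m) × Fin (3 * m))) ?_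
  rintro ⟨b, a, c⟩ h
  simp only [Finset.coe_sigma, Set.mem_sigma_iff, Finset.mem_coe, Finset.mem_univ, true_and,
    Finset.mem_offDiag, nbr, Finset.mem_filter] at h
  obtain ⟨⟨⟨hab, e1⟩, ha, hb⟩, ⟨⟨hcb, e2⟩, hc, -⟩, hac⟩ := h
  have hinj : Function.Injective ![a, b, c] := by
    intro x y hxy
    clear e1 e2
    have hba := hab.symm
    have hbc := hcb.symm
    fin_cases x <;> fin_cases y <;> simp_all
  refine ⟨⟨![a, b, c], hinj⟩, ?_, rfl⟩
  · simp only [Finset.coe_filter, Finset.mem_univ, true_and, Set.mem_ofPred_eq]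
    refine ⟨⟨hab, e1⟩, ⟨hcb.symm, ?_⟩, ha, hb⟩
    have : mkE b c hcb.symm = mkE c b hcb := Subtype.ext (Finset.pair_comm _ _)
    change Sum.inl (i, mkE b c hcb.symm) ∈ VI
    rw [this]; exact e2

theorem total_bound (m : ℕ) (hm : 1 ≤ m) (VI VII : Set (MVar m)) (δ : ℝ) (hδ : 0 < δ)
    (h : δ ≤ densityP m VI VII) (hbig : 2 ≤ δ * (3 * m - 1)) :
    δ ^ 2 / 2 * (m * (2 * m + 1)) * Fintype.card (Fin 3 ↪ Fin (3 * m)) ≤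
      ∑ i, ∑ j, ((Finset.univ.filter fun t : Fin 3 ↪ Fin (3 * m) =>
        validG VI VII i j (t 0) (t 1) (t 2)).card : ℝ) := by
  have hm' : (1 : ℝ) ≤ m := by exact_mod_cast hm
  have h1 := density_le m hm VI VII δ h
  set t : ℝ := δ * (3 * m - 1) with ht
  have h2 : ∀ i j, ∑ b, ((2 * t - 1) * ((nbr m VI VII i j b).card : ℝ) - t ^ 2) ≤
      ((Finset.univ.filter fun t : Fin 3 ↪ Fin (3 * m) =>
        validG VI VII i j (t 0) (t 1) (t 2)).card : ℝ) := by
    intro i j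
    have h3 : ((∑ b, (nbr m VI VII i j b).offDiag.card : ℕ) : ℝ) ≤
      ((Finset.univ.filter fun t : Fin 3 ↪ Fin (3 * m) =>
        validG VI VII i j (t 0) (t 1) (t 2)).card : ℝ) := by
      exact_mod_cast emb_count m VI VII i j
    refine le_trans ?_ h3
    push_cast
    refine Finset.sum_le_sum fun b _ => ?_
    rw [Finset.offDiag_card, Nat.cast_sub (Nat.le_mul_self _)]
    push_cast
    nlinarith [sq_nonneg (((nbr m VI VII i j b).card : ℝ) - t)]
  have h4 : ∀ i j, (2 * t - 1) * (2 * (EV m VI VII i j).card) - 3 * m * t ^ 2 ≤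
      ∑ b, ((2 * t - 1) * ((nbr m VI VII i j b).card : ℝ) - t ^ 2) := by
    intro i j
    rw [Finset.sum_sub_distrib, ← Finset.mul_sum]
    simp only [Finset.sum_const, Finset.card_univ, Fintype.card_fin, nsmul_eq_mul]
    push_cast
    have h5 : (2 : ℝ) * (EV m VI VII i j).card ≤ ∑ b, ((nbr m VI VII i j b).card : ℝ) := by
      exact_mod_cast nbr_sum m VI VII i j
    have := mul_le_mul_of_nonneg_left h5 (show (0 : ℝ) ≤ 2 * t - 1 by linarith)
    linarith
  refine le_trans ?_ (Finset.sum_le_sum fun i _ => Finset.sum_le_sum fun j _ => (h4 i j).trans (h2 i j))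
  simp only [Finset.sum_sub_distrib, ← Finset.mul_sum, Finset.sum_const, Finset.card_univ,
    Fintype.card_fin, nsmul_eq_mul]
  push_cast
  set S := ∑ i, ∑ j, ((EV m VI VII i j).card : ℝ) with hS
  rw [Nat.cast_choose_two] at h1
  push_cast at h1
  have hN : (Fintype.card (Fin 3 ↪ Fin (3 * m)) : ℝ) ≤ 3 * m * (3 * m - 1) ^ 2 := by
    rw [Fintype.card_embedding_eq]
    simp only [Fintype.card_fin, Nat.descFactorial, Nat.sub_zero, mul_one]
    rw [Nat.cast_mul, Nat.cast_mul, Nat.cast_sub (by omega), Nat.cast_sub (by omega)]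
    push_cast
    have : (0 : ℝ) ≤ 3 * m * (3 * m - 1) := by nlinarith
    nlinarith
  have h6 : m * (2 * m + 1) * (3 * m) * t ≤ 2 * S := by
    rw [ht]; linarith
  have h7 := mul_le_mul_of_nonneg_left h6 (show (0 : ℝ) ≤ 2 * t - 1 by linarith)
  have h8 : δ ^ 2 / 2 * (m * (2 * m + 1)) * Fintype.card (Fin 3 ↪ Fin (3 * m)) ≤
      m * (2 * m + 1) * (3 * m) * (t ^ 2 / 2) := by
    refine (mul_le_mul_of_nonneg_left hN (by positivity)).trans (le_of_eq ?_)
    rw [ht]; ring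
  refine h8.trans ?_
  have hM : (0 : ℝ) ≤ m * (2 * m + 1) * (3 * m) := by positivity
  have h9 : t ^ 2 / 2 ≤ (2 * t - 1) * t - t ^ 2 := by nlinarith
  have h10 := mul_le_mul_of_nonneg_left h9 hM
  linarith

/-- There is a good layout of vertices and labels. -/
theorem layout (m : ℕ) (hm : 1 ≤ m) (VI VII : Set (MVar m)) (δ : ℝ) (hδ : 0 < δ)
    (h : δ ≤ densityP m VI VII) (hbig : 2 ≤ δ * (3 * m - 1)) :
    ∃ (V : Fin 3 → Fin m → Fin (3 * m)) (J : Fin m ⊕ Fin m ⊕ Unit ≃ Fin (2 * m + 1)),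
      (∀ t k t' k', V t k = V t' k' → t = t' ∧ k = k') ∧
      δ ^ 2 / 2 * m ^ 2 ≤ ∑ l, ((Finset.univ.filter fun k =>
        validG VI VII k (J (Sum.inl k)) (V 0 l) (V 1 k) (V 2 k)).card : ℝ) := by
  have hm' : (1 : ℝ) ≤ m := by exact_mod_cast hm
  have hT := total_bound m hm VI VII δ hδ h hbig
  obtain ⟨J₀⟩ : Nonempty (Fin m ⊕ Fin m ⊕ Unit ≃ Fin (2 * m + 1)) :=
    ⟨Fintype.equivOfCardEq (by simp; omega)⟩
  let x : Fin m → Fin m → (Fin 3 ↪ Fin (3 * m)) := fun l k =>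
    ⟨fun t => finProdFinEquiv (t, if t = 0 then l else k), fun t t' htt => by
      have := finProdFinEquiv.injective htt
      exact (Prod.mk.inj this).1⟩
  let F : Fin m → Fin (2 * m + 1) → (Fin 3 ↪ Fin (3 * m)) → ℝ := fun i j t =>
    if validG VI VII i j (t 0) (t 1) (t 2) then 1 else 0
  have : MulAction.IsPretransitive (Equiv.Perm (Fin (3 * m))) (Fin 3 ↪ Fin (3 * m)) :=
    Equiv.Perm.isMultiplyPretransitive (Fin (3 * m)) 3
  set N : ℝ := ((Fintype.card (Fin 3 ↪ Fin (3 * m)) : ℕ) : ℝ) with hN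
  set Pc : ℝ := ((Fintype.card (Equiv.Perm (Fin (3 * m))) : ℕ) : ℝ) with hPc
  have hNpos : 0 < N := by
    rw [hN]
    exact_mod_cast Fintype.card_pos_iff.2 ⟨x ⟨0, hm⟩ ⟨0, hm⟩⟩
  have hPpos : 0 < Pc := by
    rw [hPc]
    exact_mod_cast Fintype.card_pos
  have hTF : ∑ i, ∑ j, ((Finset.univ.filter fun t : Fin 3 ↪ Fin (3 * m) =>
        validG VI VII i j (t 0) (t 1) (t 2)).card : ℝ) = ∑ i, ∑ j, ∑ t, F i j t := by
    simp [F]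
  rw [hTF] at hT
  have hsum : N * ∑ p : Equiv.Perm (Fin (3 * m)) × Fin (2 * m + 1), ∑ l, ∑ k,
      F k (J₀ (Sum.inl k) + p.2) (p.1 • x l k) = m * Pc * ∑ i, ∑ j, ∑ t, F i j t := by
    have e1 : ∑ p : Equiv.Perm (Fin (3 * m)) × Fin (2 * m + 1), ∑ l, ∑ k,
      F k (J₀ (Sum.inl k) + p.2) (p.1 • x l k) =
      ∑ l, ∑ k, ∑ s, ∑ π : Equiv.Perm (Fin (3 * m)), F k (J₀ (Sum.inl k) + s) (π • x l k) := by
      rw [Finset.sum_comm]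
      refine Finset.sum_congr rfl fun l _ => ?_
      rw [Finset.sum_comm]
      refine Finset.sum_congr rfl fun k _ => ?_
      rw [Fintype.sum_prod_type, Finset.sum_comm]
    rw [e1]
    have e2 : ∀ l k, N * ∑ s, ∑ π : Equiv.Perm (Fin (3 * m)), F k (J₀ (Sum.inl k) + s) (π • x l k)
        = Pc * ∑ j, ∑ t, F k j t := by
      intro l k
      rw [Finset.mul_sum, Finset.mul_sum, ← Equiv.sum_comp (Equiv.addLeft (J₀ (Sum.inl k)))
        (fun j => Pc * ∑ t, F k j t)]
      refine Finset.sum_congr rfl fun s _ => ?_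
      exact avg_action (F k (J₀ (Sum.inl k) + s)) (x l k)
    simp only [Finset.mul_sum] at e2 ⊢
    simp only [e2]
    simp only [Finset.sum_const, Finset.card_univ, Fintype.card_fin, nsmul_eq_mul,
      Finset.mul_sum, mul_assoc]
  have hex : ∃ p : Equiv.Perm (Fin (3 * m)) × Fin (2 * m + 1), δ ^ 2 / 2 * m ^ 2 ≤ ∑ l, ∑ k,
      F k (J₀ (Sum.inl k) + p.2) (p.1 • x l k) := by
    by_contra hcon
    push Not at hcon
    have h1 := Finset.sum_lt_sum_of_nonempty
      (s := (Finset.univ : Finset (Equiv.Perm (Fin (3 * m)) × Fin (2 * m + 1))))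
      Finset.univ_nonempty (fun p _ => hcon p)
    rw [Finset.sum_const, Finset.card_univ, Fintype.card_prod, Fintype.card_fin, nsmul_eq_mul] at h1
    have h2 := mul_lt_mul_of_pos_left h1 hNpos
    rw [hsum] at h2
    push_cast at h2
    rw [← hPc] at h2
    have h3 := mul_le_mul_of_nonneg_left hT (show 0 ≤ m * Pc by positivity)
    nlinarith
  obtain ⟨⟨π, s⟩, hp⟩ := hex
  refine ⟨fun t k => π (finProdFinEquiv (t, k)), J₀.trans (Equiv.addRight s), ?_, ?_⟩
  · intro t k t' k' htk
    have := finProdFinEquiv.injective (π.injective htk)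
    exact ⟨(Prod.mk.inj this).1, (Prod.mk.inj this).2⟩
  · refine hp.trans (le_of_eq ?_)
    refine Finset.sum_congr rfl fun l _ => ?_
    rw [Finset.natCast_card_filter]
    refine Finset.sum_congr rfl fun k _ => ?_
    rfl

/-- the key lemma: for every `δ > 0` there are constants `c₀, c₁ > 0` so
that for every `m ≥ 31(2/δ)⁸`, every partition `(𝒱I,𝒱II)` of `MVars_m` of density `≥ δ`,
and every positive `n ≤ c₀ m`, there is a finite probability space `ℒ` (taken here to be
`Fin N` with a probability mass function `μ`), assignments `A_{L,X,Y}` and planted edges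
`pe(L)` with the four stated properties. -/
theorem stmt15 (δ : ℝ) (hδ : 0 < δ) :
    ∃ c₀ : ℝ, 0 < c₀ ∧ ∃ c₁ : ℝ, 0 < c₁ ∧
      ∀ m : ℕ, 31 * (2 / δ) ^ 8 ≤ (m : ℝ) →
      ∀ VI VII : Set (MVar m), VI ∪ VII = Set.univ → VI ∩ VII = ∅ →
      δ ≤ densityP m VI VII →
      ∀ n : ℕ, 1 ≤ n → (n : ℝ) ≤ c₀ * (m : ℝ) →
      ∃ (N : ℕ) (μ : Fin N → ℝ)
        (Af : Fin N → (Fin n → Bool) → (Fin n → Bool) → MVar m → Bool)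
        (pe : Fin N → PEdge m),
        (∀ L, 0 ≤ μ L) ∧ (∑ L, μ L = 1) ∧
        (∀ L X Y Y', ∀ v ∈ VI, Af L X Y v = Af L X Y' v) ∧
        (∀ L X X' Y, ∀ v ∈ VII, Af L X Y v = Af L X' Y v) ∧
        (∀ L X Y, NonDeg m (Af L X Y)) ∧
        (∀ L X Y, ∀ e : PEdge m, BadEdge m (Af L X Y) e → e = pe L ∨ SetDisj n X Y) ∧
        (∀ X Y, SetDisj n X Y →
          ∃ Sc : Finset (Fin N),
            δ ^ 8 / 2 ^ 9 ≤ ∑ L ∈ Sc, μ L ∧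
            ∀ (A₀ : MVar m → Bool) (e : PEdge m),
              ∑ L ∈ Sc.filter (fun L => Af L X Y = A₀ ∧ pe L = e), μ L ≤
                (1 - c₁) * ∑ L ∈ Sc.filter (fun L => Af L X Y = A₀), μ L) := by
  have hc : (0 : ℝ) < min (δ ^ 2 / 8) (1 / 2) := by positivity
  refine ⟨min (δ ^ 2 / 8) (1 / 2), hc, 1 / 2, by norm_num, ?_⟩
  intro m _ VI VII _ hdisj hden n hn1 hn
  have hn1' : (1 : ℝ) ≤ n := by exact_mod_cast hn1
  have hm : 1 ≤ m := by
    rcases Nat.eq_zero_or_pos m with rfl | h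
    · simp at hn; omega
    · exact h
  have hm' : (1 : ℝ) ≤ m := by exact_mod_cast hm
  have hδ1 := delta_le_one m hm VI VII δ hden
  have hnA : (n : ℝ) ≤ δ ^ 2 / 8 * m :=
    hn.trans (mul_le_mul_of_nonneg_right (min_le_left _ _) (by positivity))
  have hnB : (n : ℝ) ≤ 1 / 2 * m :=
    hn.trans (mul_le_mul_of_nonneg_right (min_le_right _ _) (by positivity))
  have hnm : n < m := by
    have : (n : ℝ) < m := by linarith
    exact_mod_cast this
  have hbig : 2 ≤ δ * (3 * m - 1) := by
    have h1 : δ ^ 2 * m ≤ δ * m := by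
      apply mul_le_mul_of_nonneg_right _ (by positivity)
      nlinarith
    nlinarith
  obtain ⟨V, J, hV, hcnt⟩ := layout m hm VI VII δ hδ hden hbig
  set ε : ℝ := δ ^ 2 / 4 with hε
  let cnt : Fin m → ℝ := fun l => ((Finset.univ.filter fun k =>
        validG VI VII k (J (Sum.inl k)) (V 0 l) (V 1 k) (V 2 k)).card : ℝ)
  set good : Finset (Fin m) := Finset.univ.filter fun l => ε * m ≤ cnt l with hgood
  have hcm : ∀ l, cnt l ≤ m := by
    intro l
    have := Finset.card_le_univ (Finset.univ.filter fun k =>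
        validG VI VII k (J (Sum.inl k)) (V 0 l) (V 1 k) (V 2 k))
    rw [Fintype.card_fin] at this
    simp only [cnt]
    exact_mod_cast this
  have hgc : n ≤ good.card := by
    have h1 : ∑ l, cnt l ≤ ∑ l, ((if l ∈ good then (m : ℝ) else 0) + ε * m) := by
      refine Finset.sum_le_sum fun l _ => ?_
      have hpos : 0 ≤ ε * m := by positivity
      by_cases hl : l ∈ good
      · rw [if_pos hl]; linarith [hcm l]
      · rw [if_neg hl]
        simp only [hgood, Finset.mem_filter, Finset.mem_univ, true_and, not_le] at hl
        linarith
    rw [Finset.sum_add_distrib, Finset.sum_ite_mem] at h1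
    simp only [Finset.univ_inter, Finset.sum_const, Finset.card_univ, Fintype.card_fin,
      nsmul_eq_mul] at h1
    have h2 : δ ^ 2 / 2 * m ^ 2 ≤ good.card * m + m * (ε * m) := hcnt.trans h1
    have h3 : (ε * m) * m ≤ good.card * m := by
      rw [hε] at h2 ⊢
      linarith
    have h4 : ε * m ≤ good.card := le_of_mul_le_mul_right h3 (by linarith)
    have h5 : (n : ℝ) ≤ good.card := by
      refine le_trans ?_ h4
      rw [hε]
      linarith
    exact_mod_cast h5
  let g : Fin n ↪ Fin m := (good.orderEmbOfCardLe hgc).toEmbedding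
  have hg : ∀ i, g i ∈ good := fun i => Finset.orderEmbOfCardLe_mem good hgc i
  obtain ⟨s, hs⟩ : ∃ s, ∀ i, g i ≠ s := by
    by_contra hcon
    push Not at hcon
    have := Fintype.card_le_of_surjective g hcon
    simp at this
    omega
  obtain ⟨N, μ, Af, pe, p1, p2, p3, p4, p5, p6, p7⟩ :=
    construct m n VI VII hdisj V hV J g s hs ε (fun i => by
      have := hg i
      simp only [hgood, Finset.mem_filter, Finset.mem_univ, true_and] at this
      exact this) (by rw [hε]; linarith)
  refine ⟨N, μ, Af, pe, p1, p2, p3, p4, p5, p6, fun X Y hXY => ?_⟩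
  obtain ⟨Sc, q1, q2⟩ := p7 X Y hXY
  refine ⟨Sc, le_trans ?_ q1, q2⟩
  have hp : δ ^ 8 ≤ δ ^ 2 := pow_le_pow_of_le_one hδ.le hδ1 (by norm_num)
  have hp0 : 0 ≤ δ ^ 2 := by positivity
  rw [hε]
  linarith
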